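/- (Deadline Lemma, part 2) In a regular run, let x be a track and let (α,β) be an interval such that TrackStatus(x,t) ≠ incrossing for all t ∈ (α,β). Then Deadline(x,t) ≥ β − D_close for all t ∈ (α,β), where D_close = d_close + (d_max − d_min) = d_max − WaitTime. -/

import Mathlib

namespace RailCross

inductive TStat : Type
  | emp | coming | incrossing
deriving DecidableEq

inductive DirV : Type
  | opn | cls
deriving DecidableEq

inductive GateV : Type
  | opened | closed
deriving DecidableEq

/-- `f` is piecewise constant on `[0, ∞)`: for every `τ > 0` there is a finite
partition `0 = s 0 < s 1 < … < s n = τ` such that `f` is constant on each open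
subinterval `(s i, s (i+1))`. -/
def PWC {Y : Type*} (f : ℝ → Y) : Prop :=
  ∀ τ : ℝ, 0 < τ → ∃ n : ℕ, ∃ s : ℕ → ℝ,
    s 0 = 0 ∧ s n = τ ∧ (∀ i < n, s i < s (i + 1)) ∧
    (∀ i < n, ∀ a b : ℝ, s i < a → a < b → b < s (i + 1) → f a = f b)

/-- `v` is the right-hand value `f(t+)`: `f` is constantly `v` on some `(t, t+ε)`. -/
def RightVal {Y : Type*} (f : ℝ → Y) (t : ℝ) (v : Y) : Prop :=
  ∃ ε : ℝ, 0 < ε ∧ ∀ u : ℝ, t < u → u < t + ε → f u = v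

/-- `v` is the left-hand value `f(t−)` (for `t > 0`): `f` is constantly `v` on some `(t-ε, t)`. -/
def LeftVal {Y : Type*} (f : ℝ → Y) (t : ℝ) (v : Y) : Prop :=
  ∃ ε : ℝ, 0 < ε ∧ ε ≤ t ∧ ∀ u : ℝ, t - ε < u → u < t → f u = v

/-- `tm` is the (finite or infinite) increasing sequence of significant moments of a
track with status function `f`; a finite sequence is encoded by letting `tm` take the
value `⊤ = ∞` from some point on. -/
structure TrainMotion (dmin dmax : ℝ) (f : ℝ → TStat) (tm : ℕ → EReal) : Prop where
  zero : tm 0 = 0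
  mono : Monotone tm
  strict : ∀ i, tm i ≠ ⊤ → tm i < tm (i + 1)
  last_div : ∀ k, tm k ≠ ⊤ → tm (k + 1) = ⊤ → 3 ∣ k
  status_empty : ∀ i : ℕ, ∀ u : ℝ, tm (3 * i) ≤ (u : EReal) → (u : EReal) < tm (3 * i + 1) →
    f u = TStat.emp
  status_coming : ∀ i : ℕ, ∀ u : ℝ, tm (3 * i + 1) ≤ (u : EReal) → (u : EReal) < tm (3 * i + 2) →
    f u = TStat.coming
  status_cross : ∀ i : ℕ, ∀ u : ℝ, tm (3 * i + 2) ≤ (u : EReal) → (u : EReal) < tm (3 * i + 3) →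
    f u = TStat.incrossing
  gap : ∀ i : ℕ, ∀ a b : ℝ, tm (3 * i + 1) = (a : EReal) → tm (3 * i + 2) = (b : EReal) →
    dmin ≤ b - a ∧ b - a ≤ dmax

/-- `SafeToOpen(t)`: every track is empty or its deadline is more than `dopen` away. -/
def SafeToOpen {Tracks : Type*} (dopen : ℝ) (trackStatus : Tracks → ℝ → TStat)
    (deadline : Tracks → ℝ → EReal) (t : ℝ) : Prop :=
  ∀ x : Tracks, trackStatus x t = TStat.emp ∨ ((t + dopen : ℝ) : EReal) < deadline x t

/-- A regular run of the railroad-crossing evolving algebra.  `WaitTime = dmin - dclose`. -/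
structure RegularRun (Tracks : Type*) (dmin dmax dopen dclose : ℝ) where
  trackStatus : Tracks → ℝ → TStat
  deadline : Tracks → ℝ → EReal
  dir : ℝ → DirV
  gate : ℝ → GateV
  /-- the right-hand value `Deadline(x, t+)` -/
  deadlinePlus : Tracks → ℝ → EReal
  /-- the right-hand value `Dir(t+)` -/
  dirPlus : ℝ → DirV
  /-- the right-hand value `GateStatus(t+)` -/
  gatePlus : ℝ → GateV
  pwc_ts : ∀ x, PWC (trackStatus x)
  pwc_dl : ∀ x, PWC (deadline x)
  pwc_dir : PWC dir
  pwc_gate : PWC gate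
  dlPlus_spec : ∀ x, ∀ t : ℝ, 0 ≤ t → RightVal (deadline x) t (deadlinePlus x t)
  dirPlus_spec : ∀ t : ℝ, 0 ≤ t → RightVal dir t (dirPlus t)
  gatePlus_spec : ∀ t : ℝ, 0 ≤ t → RightVal gate t (gatePlus t)
  dl_left : ∀ x, ∀ t : ℝ, 0 < t → LeftVal (deadline x) t (deadline x t)
  dir_left : ∀ t : ℝ, 0 < t → LeftVal dir t (dir t)
  gate_left : ∀ t : ℝ, 0 < t → LeftVal gate t (gate t)
  trainMotion : ∀ x, ∃ tm : ℕ → EReal, TrainMotion dmin dmax (trackStatus x) tm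
  dl_init : ∀ x, deadline x 0 = ⊤
  dir_init : dir 0 = DirV.opn
  gate_init : gate 0 = GateV.opened
  dl_step_coming : ∀ x, ∀ t : ℝ, 0 ≤ t → trackStatus x t = TStat.coming → deadline x t = ⊤ →
    deadlinePlus x t = ((t + (dmin - dclose) : ℝ) : EReal)
  dl_step_empty : ∀ x, ∀ t : ℝ, 0 ≤ t → trackStatus x t = TStat.emp → deadline x t ≠ ⊤ →
    deadlinePlus x t = ⊤
  dl_step_other : ∀ x, ∀ t : ℝ, 0 ≤ t →
    ¬(trackStatus x t = TStat.coming ∧ deadline x t = ⊤) →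
    ¬(trackStatus x t = TStat.emp ∧ deadline x t ≠ ⊤) →
    deadlinePlus x t = deadline x t
  dir_step_close : ∀ t : ℝ, 0 ≤ t → (∃ x, deadline x t = (t : EReal)) → dirPlus t = DirV.cls
  dir_step_open : ∀ t : ℝ, 0 ≤ t → (∀ x, deadline x t ≠ (t : EReal)) → dir t = DirV.cls →
    SafeToOpen dopen trackStatus deadline t → dirPlus t = DirV.opn
  dir_step_other : ∀ t : ℝ, 0 ≤ t → (∀ x, deadline x t ≠ (t : EReal)) →
    ¬(dir t = DirV.cls ∧ SafeToOpen dopen trackStatus deadline t) → dirPlus t = dir t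
  gate_step : ∀ t : ℝ, 0 ≤ t →
    gatePlus t = gate t ∨ (dir t = DirV.opn ∧ gatePlus t = GateV.opened) ∨
      (dir t = DirV.cls ∧ gatePlus t = GateV.closed)
  gate_close_bound : ∀ t : ℝ, 0 ≤ t →
    ¬(∀ u ∈ Set.Ioo t (t + dclose), dir u = DirV.cls ∧ gate u = GateV.opened)
  gate_open_bound : ∀ t : ℝ, 0 ≤ t →
    ¬(∀ u ∈ Set.Ioo t (t + dopen), dir u = DirV.opn ∧ gate u = GateV.closed)

theorem TrainMotion.exists_real {dmin dmax : ℝ} {f : ℝ → TStat} {tm : ℕ → EReal}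
    (h : TrainMotion dmin dmax f tm) {n : ℕ} (hn : tm n ≠ ⊤) :
    ∃ r : ℝ, 0 ≤ r ∧ tm n = (r : EReal) := by
  have h0 : (0 : EReal) ≤ tm n := h.zero ▸ h.mono (Nat.zero_le n)
  have hbot : tm n ≠ ⊥ := fun hb => by simp [hb] at h0
  have hr : ((tm n).toReal : EReal) = tm n := EReal.coe_toReal hn hbot
  exact ⟨(tm n).toReal, EReal.toReal_nonneg h0, hr.symm⟩

theorem TrainMotion.exists_lt {dmin dmax : ℝ} {f : ℝ → TStat} {tm : ℕ → EReal}
    (h : TrainMotion dmin dmax f tm) (hdmin : 0 < dmin) (t : ℝ) : ∃ n, (t : EReal) < tm n := by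
  by_contra! hle
  have hfin : ∀ n, tm n ≠ ⊤ := fun n => ((hle n).trans_lt (EReal.coe_lt_top t)).ne
  choose r hr0 hr using fun n => h.exists_real (hfin n)
  have hmono : Monotone r := fun m n hmn => by
    have := h.mono hmn
    rw [hr m, hr n] at this
    exact_mod_cast this
  have key : ∀ i : ℕ, (i : ℝ) * dmin ≤ r (3 * i) := by
    intro i
    induction i with
    | zero => simpa using hr0 0
    | succ i ih =>
      have h1 := (h.gap i _ _ (hr _) (hr _)).1
      have h2 : r (3 * i) ≤ r (3 * i + 1) := hmono (by omega)
      have h3 : r (3 * i + 2) ≤ r (3 * (i + 1)) := hmono (by omega)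
      push_cast
      linarith
  obtain ⟨k, hk⟩ := exists_nat_gt (t / dmin)
  have h1 := hle (3 * k)
  rw [hr] at h1
  have h2 : r (3 * k) ≤ t := by exact_mod_cast h1
  have h3 := key k
  rw [div_lt_iff₀ hdmin] at hk
  linarith

/-- Every time lies between two consecutive significant moments. -/
theorem TrainMotion.exists_mem_interval {dmin dmax : ℝ} {f : ℝ → TStat} {tm : ℕ → EReal}
    (h : TrainMotion dmin dmax f tm) (hdmin : 0 < dmin) {t : ℝ} (ht : 0 ≤ t) :
    ∃ n, tm n ≤ (t : EReal) ∧ (t : EReal) < tm (n + 1) := by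
  classical
  have hex := h.exists_lt hdmin t
  have hspec := Nat.find_spec hex
  have hmin := fun m => Nat.find_min hex (m := m)
  rcases hn : Nat.find hex with _ | n
  · rw [hn, h.zero] at hspec
    exact absurd hspec (not_lt.2 (by exact_mod_cast ht))
  · rw [hn] at hspec hmin
    exact ⟨n, not_lt.1 (hmin n n.lt_succ_self), hspec⟩

/-- A left-continuous piecewise constant function keeps the value `v` on `(a, b]` if its
right-hand value is `v` at `a` and at each point of `(a, b)` where its value is `v`. -/
theorem eq_on_Ioc_of_rightVal {Y : Type*} {f g : ℝ → Y} {a b : ℝ} {v : Y} (ha : 0 ≤ a)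
    (hright : ∀ t, 0 ≤ t → RightVal f t (g t)) (hleft : ∀ t, 0 < t → LeftVal f t (f t))
    (hga : g a = v) (hg : ∀ u ∈ Set.Ioo a b, f u = v → g u = v) :
    ∀ u ∈ Set.Ioc a b, f u = v := by
  by_contra! hne
  set S : Set ℝ := {u | u ∈ Set.Ioc a b ∧ f u ≠ v} with hS
  have hSne : S.Nonempty := hne
  have hbdd : BddBelow S := ⟨a, fun u hu => hu.1.1.le⟩
  obtain ⟨ε, hε, hfε⟩ := hright a ha
  have has : a + ε ≤ sInf S := le_csInf hSne fun u hu => by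
    by_contra! hlt
    exact hu.2 ((hfε u hu.1.1 hlt).trans hga)
  have hsb : sInf S ≤ b := by
    obtain ⟨u, hu⟩ := hSne
    exact (csInf_le hbdd hu).trans hu.1.2
  have hbefore : ∀ u, a < u → u < sInf S → f u = v := fun u hau hus => by
    by_contra hfu
    exact absurd (csInf_le hbdd (show u ∈ S from ⟨⟨hau, hus.le.trans hsb⟩, hfu⟩)) (not_le.2 hus)
  have hfs : f (sInf S) = v := by
    obtain ⟨δ, hδ, -, hfδ⟩ := hleft (sInf S) (by linarith)
    obtain ⟨u, hu1, hu2⟩ := exists_between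
      (max_lt (by linarith : a < sInf S) (by linarith : sInf S - δ < sInf S))
    rw [max_lt_iff] at hu1
    rw [← hfδ u hu1.2 hu2, hbefore u hu1.1 hu2]
  obtain ⟨δ, hδ, hfδ⟩ := hright (sInf S) (by linarith)
  obtain ⟨u, huS, hu⟩ := exists_lt_of_csInf_lt hSne (by linarith : sInf S < sInf S + δ)
  rcases (csInf_le hbdd huS).eq_or_lt with heq | hlt
  · exact huS.2 (heq ▸ hfs)
  · exact huS.2 ((hfδ u hlt hu).trans (hg _ ⟨by linarith, hlt.trans_le huS.1.2⟩ hfs))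

namespace RegularRun

variable {Tracks : Type*} {dmin dmax dopen dclose : ℝ} (R : RegularRun Tracks dmin dmax dopen dclose)
  {x : Tracks}

theorem deadlinePlus_of_emp {t : ℝ} (ht : 0 ≤ t) (h : R.trackStatus x t = TStat.emp) :
    R.deadlinePlus x t = ⊤ := by
  by_cases hd : R.deadline x t = ⊤
  · rw [R.dl_step_other x t ht (by simp [h]) (by simp [hd]), hd]
  · exact R.dl_step_empty x t ht h hd

theorem deadline_eq_top_of_emp {a b : ℝ} (ha : 0 ≤ a) (hab : a < b)
    (h : ∀ u ∈ Set.Ico a b, R.trackStatus x u = TStat.emp) : R.deadline x b = ⊤ :=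
  eq_on_Ioc_of_rightVal ha (R.dlPlus_spec x) (R.dl_left x)
    (R.deadlinePlus_of_emp ha (h a ⟨le_rfl, hab⟩))
    (fun u hu _ => R.deadlinePlus_of_emp (ha.trans hu.1.le) (h u ⟨hu.1.le, hu.2⟩)) b ⟨hab, le_rfl⟩

theorem deadline_eq_of_coming {c b : ℝ} (hc : 0 ≤ c) (hcb : c < b) (htop : R.deadline x c = ⊤)
    (h : ∀ u ∈ Set.Ico c b, R.trackStatus x u = TStat.coming) :
    R.deadline x b = ((c + (dmin - dclose) : ℝ) : EReal) := by
  refine eq_on_Ioc_of_rightVal hc (R.dlPlus_spec x) (R.dl_left x)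
    (R.dl_step_coming x c hc (h c ⟨le_rfl, hcb⟩) htop) (fun u hu hfu => ?_) b ⟨hcb, le_rfl⟩
  have hne : R.deadline x u ≠ ⊤ := hfu ▸ EReal.coe_ne_top _
  rw [R.dl_step_other x u (hc.trans hu.1.le) (by simp [hne]) (by simp [h u ⟨hu.1.le, hu.2⟩]), hfu]

end RegularRun

theorem TrainMotion.ne_of_forall_ne_incrossing {dmin dmax : ℝ} {f : ℝ → TStat} {tm : ℕ → EReal}
    (h : TrainMotion dmin dmax f tm) {α t a : ℝ} {i : ℕ} (hα : 0 ≤ α) (hαt : α < t)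
    (hne : ∀ u ∈ Set.Ioo α t, f u ≠ TStat.incrossing) (ha : tm (3 * i) = (a : EReal)) :
    a ≠ t := by
  rintro rfl
  rcases i with _ | i
  · have h0 := h.zero
    rw [show tm 0 = (a : EReal) from ha] at h0
    have : a = 0 := by exact_mod_cast h0
    linarith
  · have ha' : tm (3 * i + 3) = (a : EReal) := ha
    have hfin : tm (3 * i + 2) ≠ ⊤ :=
      ((h.mono (by omega : 3 * i + 2 ≤ 3 * i + 3)).trans_lt (ha' ▸ EReal.coe_lt_top a)).ne
    obtain ⟨d, -, hd⟩ := h.exists_real hfin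
    have hlt := h.strict _ hfin
    rw [hd, show 3 * i + 2 + 1 = 3 * i + 3 from rfl, ha'] at hlt
    have hda : d < a := by exact_mod_cast hlt
    obtain ⟨u, hu1, hu2⟩ := exists_between (max_lt hαt hda)
    rw [max_lt_iff] at hu1
    refine hne u ⟨hu1.1, hu2⟩ (h.status_cross i u ?_ ?_)
    · rw [hd]; exact_mod_cast hu1.2.le
    · rw [ha']; exact_mod_cast hu2

theorem deadline_lemma_part2 {Tracks : Type*} [Fintype Tracks] [Nonempty Tracks]
    {dmin dmax dopen dclose : ℝ}
    (hdmin : 0 < dmin) (hdmax : 0 < dmax) (hdopen : 0 < dopen) (hdclose : 0 < dclose)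
    (hcm : dclose < dmin) (hmm : dmin ≤ dmax)
    (R : RegularRun Tracks dmin dmax dopen dclose)
    (x : Tracks) (α β : ℝ) (hα : 0 ≤ α)
    (hempty : ∀ t ∈ Set.Ioo α β, R.trackStatus x t ≠ TStat.incrossing) :
    ∀ t ∈ Set.Ioo α β, ((β - (dclose + (dmax - dmin)) : ℝ) : EReal) ≤ R.deadline x t := by
  rintro t ⟨hαt, htβ⟩
  obtain ⟨tm, h⟩ := R.trainMotion x
  obtain ⟨n, hn1, hn2⟩ := h.exists_mem_interval hdmin (hα.trans hαt.le)
  obtain ⟨i, hi⟩ : ∃ i, n = 3 * i ∨ n = 3 * i + 1 ∨ n = 3 * i + 2 := ⟨n / 3, by omega⟩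
  have hafin : tm (3 * i) ≠ ⊤ :=
    ((h.mono (by omega)).trans_lt (hn1.trans_lt (EReal.coe_lt_top t))).ne
  obtain ⟨a, ha0, ha⟩ := h.exists_real hafin
  rcases hi with rfl | rfl | rfl
  · have hat : a < t := by
      have hle : a ≤ t := by rw [ha] at hn1; exact_mod_cast hn1
      exact hle.lt_of_ne (h.ne_of_forall_ne_incrossing hα hαt
        (fun u hu => hempty u ⟨hu.1, hu.2.trans htβ⟩) ha)
    rw [R.deadline_eq_top_of_emp ha0 hat fun u hu => h.status_empty i u
      (by rw [ha]; exact_mod_cast hu.1)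
      ((by exact_mod_cast hu.2 : (u : EReal) < t).trans hn2)]
    exact le_top
  · have hcfin : tm (3 * i + 1) ≠ ⊤ := (hn1.trans_lt (EReal.coe_lt_top t)).ne
    obtain ⟨c, hc0, hc⟩ := h.exists_real hcfin
    have hac : a < c := by
      have := h.strict _ hafin
      rw [ha, hc] at this
      exact_mod_cast this
    have htop : R.deadline x c = ⊤ := R.deadline_eq_top_of_emp ha0 hac fun u hu =>
      h.status_empty i u (by rw [ha]; exact_mod_cast hu.1) (by rw [hc]; exact_mod_cast hu.2)
    have hct : c ≤ t := by rw [hc] at hn1; exact_mod_cast hn1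
    rcases hct.eq_or_lt with rfl | hct
    · rw [htop]
      exact le_top
    rw [R.deadline_eq_of_coming hc0 hct htop fun u hu => h.status_coming i u
      (by rw [hc]; exact_mod_cast hu.1)
      ((by exact_mod_cast hu.2 : (u : EReal) < t).trans hn2)]
    have hbfin : tm (3 * i + 2) ≠ ⊤ := fun hb => by
      have := h.last_div _ hcfin hb
      omega
    obtain ⟨b, -, hb⟩ := h.exists_real hbfin
    have htb : t < b := by
      rw [show 3 * i + 1 + 1 = 3 * i + 2 from rfl, hb] at hn2
      exact_mod_cast hn2
    have hβb : β ≤ b := by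
      by_contra! hlt
      have hs := h.strict _ hbfin
      rw [hb] at hs
      exact hempty b ⟨hαt.trans htb, hlt⟩ (h.status_cross i b hb.le hs)
    have hgap := (h.gap i c b hc hb).2
    exact EReal.coe_le_coe_iff.2 (by linarith)
  · exact absurd (h.status_cross i t hn1 hn2) (hempty t ⟨hαt, htβ⟩)

end RailCross
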